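/- arXiv:1106.3984 — 2 statements merged into one kernel-verified Lean document; each statement's English description precedes it below -/
import Mathlib

section
/- Under the same assumptions, the conditional distributions P_n defined by P_n(B) = E[1{R^n ∈ B} 1_{A_n}] / E[1_{A_n}] form a consistent family: for any measurable function f of the n×n overlap matrix R^n, E[f(R^n) 1_{A_{n+1}}]/E[1_{A_{n+1}}] = E[f(R^n) 1_{A_n}]/E[1_{A_n}]. Consequently, by Kolmogorov's extension theorem there exists an infinite random array Q = (Q_{l,l'}) whose n×n marginal distribution is P_n for each n. -/
open MeasureTheory
open scoped RealInnerProductSpace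

/-- The event that the first `n` replicas are pairwise distinct. -/
def distinctEvent {Ω X : Type*} (σ : ℕ → Ω → X) (n : ℕ) : Set Ω :=
  {ω | ∀ i j, i < n → j < n → i ≠ j → σ i ω ≠ σ j ω}

lemma indicator_step {Ω H : Type*} (σ : ℕ → Ω → H) (R : ℕ → ℕ → Ω → ℝ) (qk : ℝ)
    (heq : ∀ l l', l ≠ l' → ∀ ω, (R l l' ω = qk ↔ σ l ω = σ l' ω)) (n : ℕ) (ω : Ω) :
    Set.indicator (distinctEvent σ (n + 1)) (fun _ => (1 : ℝ)) ω
      = Set.indicator (distinctEvent σ n) (fun _ => (1 : ℝ)) ω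
        - ∑ i : Fin n, Set.indicator (distinctEvent σ n) (fun _ => (1 : ℝ)) ω
            * Set.indicator {qk} (fun _ => (1 : ℝ)) (R i n ω) := by
  classical
  have hψ : ∀ i : Fin n, Set.indicator {qk} (fun _ => (1 : ℝ)) (R i n ω)
      = if σ i ω = σ n ω then 1 else 0 := by
    intro i
    rw [Set.indicator_apply]
    simp only [Set.mem_singleton_iff, heq i n i.2.ne ω]
  simp only [hψ]
  by_cases hA : ω ∈ distinctEvent σ n
  · rw [Set.indicator_of_mem hA]
    by_cases hB : ω ∈ distinctEvent σ (n + 1)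
    · rw [Set.indicator_of_mem hB, Finset.sum_eq_zero]
      · simp
      · intro i _
        rw [if_neg, mul_zero]
        exact hB i n (by omega) (by omega) i.2.ne
    · rw [Set.indicator_of_notMem hB]
      have : ∃ i : Fin n, σ i ω = σ n ω := by
        by_contra! hc
        apply hB
        intro i j hi hj hij
        rcases Nat.lt_succ_iff_lt_or_eq.1 hi with hi | rfl
        · rcases Nat.lt_succ_iff_lt_or_eq.1 hj with hj | rfl
          · exact hA i j hi hj hij
          · exact hc ⟨i, hi⟩
        · rcases Nat.lt_succ_iff_lt_or_eq.1 hj with hj | rfl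
          · exact (hc ⟨j, hj⟩).symm
          · exact absurd rfl hij
      obtain ⟨i, hi⟩ := this
      rw [Finset.sum_eq_single i]
      · simp [hi]
      · intro j _ hj
        rw [if_neg, mul_zero]
        intro h
        exact hA j i j.2 i.2 (fun h => hj (Fin.ext h)) (h.trans hi.symm)
      · simp
  · have hB : ω ∉ distinctEvent σ (n + 1) := fun h => hA fun i j hi hj => h i j (by omega) (by omega)
    simp [hA, hB]

lemma distinct_iff {Ω H : Type*} (σ : ℕ → Ω → H) (R : ℕ → ℕ → Ω → ℝ) (qk : ℝ)
    (heq : ∀ l l', l ≠ l' → ∀ ω, (R l l' ω = qk ↔ σ l ω = σ l' ω)) (n : ℕ) (ω : Ω) :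
    ω ∈ distinctEvent σ n ↔
      (fun i j : Fin n => R i j ω) ∈ {x : Fin n → Fin n → ℝ | ∀ i j, i ≠ j → x i j ≠ qk} := by
  constructor
  · intro h i j hij
    have hij' : (i : ℕ) ≠ j := fun h => hij (Fin.ext h)
    exact fun hh => h i j i.2 j.2 hij' ((heq _ _ hij' ω).1 hh)
  · intro h i j hi hj hij hh
    exact h ⟨i, hi⟩ ⟨j, hj⟩ (by simpa using hij) ((heq _ _ hij ω).2 hh)

lemma measurableSet_D (n : ℕ) (qk : ℝ) :
    MeasurableSet {x : Fin n → Fin n → ℝ | ∀ i j, i ≠ j → x i j ≠ qk} := by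
  simp only [Set.ofPred_forall]
  refine MeasurableSet.iInter fun i => MeasurableSet.iInter fun j => MeasurableSet.iInter fun _ => ?_
  have : Measurable fun x : Fin n → Fin n → ℝ => x i j := by fun_prop
  exact (this (measurableSet_singleton qk)).compl

lemma per_index {Ω : Type*} [MeasurableSpace Ω] (ℙ : Measure Ω) [IsProbabilityMeasure ℙ]
    (R : ℕ → ℕ → Ω → ℝ) (qk : ℝ)
    (hdiag : ∀ l ω, R l l ω = qk)
    (hmeas : ∀ l l', Measurable (fun ω => R l l' ω))
    (hexch : ∀ (m : ℕ) (ρ : Equiv.Perm (Fin m)),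
      Measure.map (fun ω => fun i j : Fin m => R (ρ i) (ρ j) ω) ℙ
        = Measure.map (fun ω => fun i j : Fin m => R i j ω) ℙ)
    (hGG : ∀ m, 2 ≤ m → ∀ f : (Fin m → Fin m → ℝ) → ℝ, Measurable f →
      (∃ C, ∀ x, |f x| ≤ C) → ∀ ψ : ℝ → ℝ, Measurable ψ → (∃ C, ∀ x, |ψ x| ≤ C) →
      ∫ ω, f (fun i j : Fin m => R i j ω) * ψ (R 0 m ω) ∂ℙ
        = (1 / m) * (∫ ω, f (fun i j : Fin m => R i j ω) ∂ℙ)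
              * (∫ ω, ψ (R 0 1 ω) ∂ℙ)
          + (1 / m) * ∑ l ∈ Finset.Ico 1 m,
              ∫ ω, f (fun i j : Fin m => R i j ω) * ψ (R 0 l ω) ∂ℙ)
    (n : ℕ) (hn : 1 ≤ n) (g : (Fin n → Fin n → ℝ) → ℝ) (hg : Measurable g)
    (hgb : ∃ C, ∀ x, |g x| ≤ C)
    (hgD : ∀ x i j, i ≠ j → x i j = qk → g x = 0) (i : Fin n) :
    ∫ ω, g (fun i j : Fin n => R i j ω) * Set.indicator {qk} (fun _ => (1 : ℝ)) (R i n ω) ∂ℙ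
      = (1 / n) * (∫ ω, g (fun i j : Fin n => R i j ω) ∂ℙ)
        * ∫ ω, Set.indicator {qk} (fun _ => (1 : ℝ)) (R 0 1 ω) ∂ℙ := by
  set ψ : ℝ → ℝ := Set.indicator {qk} (fun _ => (1 : ℝ)) with hψdef
  have hψ : Measurable ψ := measurable_const.indicator (measurableSet_singleton qk)
  have hψb : ∃ C, ∀ x, |ψ x| ≤ C := ⟨1, fun x => by
    rw [hψdef, Set.indicator_apply]; split_ifs <;> simp⟩
  have hmeasM : ∀ (m : ℕ) (ρ : Fin m → Fin m),
      Measurable (fun ω => fun i j : Fin m => R (ρ i) (ρ j) ω) := by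
    intro m ρ
    exact measurable_pi_lambda _ fun a => measurable_pi_lambda _ fun b => hmeas _ _
  have hex : ∀ (m : ℕ) (ρ : Equiv.Perm (Fin m)) (F : (Fin m → Fin m → ℝ) → ℝ), Measurable F →
      ∫ ω, F (fun i j : Fin m => R (ρ i) (ρ j) ω) ∂ℙ = ∫ ω, F (fun i j : Fin m => R i j ω) ∂ℙ := by
    intro m ρ F hF
    have h1 := integral_map (μ := ℙ) (hmeasM m ρ).aemeasurable (f := F) hF.aestronglyMeasurable
    have h2 := integral_map (μ := ℙ) (hmeasM m id).aemeasurable (f := F) hF.aestronglyMeasurable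
    rw [hexch m ρ] at h1
    exact h1.symm.trans h2
  rcases Nat.lt_or_ge n 2 with h2 | h2
  · obtain rfl : n = 1 := by omega
    have hc : ∀ ω, g (fun i j : Fin 1 => R i j ω) = g (fun _ _ => qk) := by
      intro ω
      congr 1
      funext a b
      rw [Subsingleton.elim a b, hdiag]
    have hi : (i : ℕ) = 0 := by omega
    simp only [hc, hi]
    rw [integral_const_mul]
    simp
  · have : NeZero n := ⟨by omega⟩
    let s : Equiv.Perm (Fin n) := Equiv.swap 0 i
    let ρ : Equiv.Perm (Fin (n + 1)) := Equiv.swap (Fin.castSucc 0) i.castSucc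
    have hρ : ∀ a : Fin n, ρ a.castSucc = (s a).castSucc := by
      intro a
      simp only [ρ, s, Equiv.swap_apply_def, Fin.castSucc_inj]
      split_ifs <;> rfl
    have hρl : ρ (Fin.last n) = Fin.last n := by
      apply Equiv.swap_apply_of_ne_of_ne
      · exact (Fin.castSucc_lt_last _).ne'
      · exact (Fin.castSucc_lt_last _).ne'
    let F : (Fin (n+1) → Fin (n+1) → ℝ) → ℝ := fun x =>
      g (fun a b => x a.castSucc b.castSucc) * ψ (x i.castSucc (Fin.last n))
    have hF : Measurable F := by
      apply Measurable.mul
      · exact hg.comp (measurable_pi_lambda _ fun a => measurable_pi_lambda _ fun b => by fun_prop)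
      · exact hψ.comp (by fun_prop)
    have e1 := hex (n+1) ρ F hF
    let g' : (Fin n → Fin n → ℝ) → ℝ := fun x => g (fun a b => x (s a) (s b))
    have hg' : Measurable g' :=
      hg.comp (measurable_pi_lambda _ fun a => measurable_pi_lambda _ fun b => by fun_prop)
    have e2 := hGG n h2 g' hg' (hgb.imp fun C h x => h _) ψ hψ hψb
    have e3 := hex n s g hg
    have hsi : s i = 0 := Equiv.swap_apply_right _ _
    rw [Finset.sum_eq_zero, mul_zero, add_zero] at e2
    · simp only [F, hρ, hρl, hsi, Fin.val_castSucc, Fin.val_last, Fin.val_zero] at e1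
      rw [← e1, ← e3]
      exact e2
    · intro l hl
      rw [Finset.mem_Ico] at hl
      apply integral_eq_zero_of_ae
      refine Filter.Eventually.of_forall fun ω => ?_
      by_cases h : R 0 l ω = qk
      · have : g' (fun i j : Fin n => R i j ω) = 0 := by
          apply hgD _ (s.symm 0) (s.symm ⟨l, hl.2⟩)
          · intro hh
            have := congrArg Fin.val (s.symm.injective hh)
            simp at this
            omega
          · simpa using h
        simp [this]
      · simp [hψdef, h]

lemma key_step {Ω : Type*} [MeasurableSpace Ω] (ℙ : Measure Ω) [IsProbabilityMeasure ℙ]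
    {H : Type*} (σ : ℕ → Ω → H)
    (R : ℕ → ℕ → Ω → ℝ) (qk : ℝ)
    (heq : ∀ l l', l ≠ l' → ∀ ω, (R l l' ω = qk ↔ σ l ω = σ l' ω))
    (hdiag : ∀ l ω, R l l ω = qk)
    (hmeas : ∀ l l', Measurable (fun ω => R l l' ω))
    (hexch : ∀ (m : ℕ) (ρ : Equiv.Perm (Fin m)),
      Measure.map (fun ω => fun i j : Fin m => R (ρ i) (ρ j) ω) ℙ
        = Measure.map (fun ω => fun i j : Fin m => R i j ω) ℙ)
    (hGG : ∀ m, 2 ≤ m → ∀ f : (Fin m → Fin m → ℝ) → ℝ, Measurable f →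
      (∃ C, ∀ x, |f x| ≤ C) → ∀ ψ : ℝ → ℝ, Measurable ψ → (∃ C, ∀ x, |ψ x| ≤ C) →
      ∫ ω, f (fun i j : Fin m => R i j ω) * ψ (R 0 m ω) ∂ℙ
        = (1 / m) * (∫ ω, f (fun i j : Fin m => R i j ω) ∂ℙ)
              * (∫ ω, ψ (R 0 1 ω) ∂ℙ)
          + (1 / m) * ∑ l ∈ Finset.Ico 1 m,
              ∫ ω, f (fun i j : Fin m => R i j ω) * ψ (R 0 l ω) ∂ℙ)
    (n : ℕ) (hn : 1 ≤ n) (f : (Fin n → Fin n → ℝ) → ℝ) (hf : Measurable f)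
    (hfb : ∃ C, ∀ x, |f x| ≤ C) :
    ∫ ω, f (fun i j : Fin n => R i j ω)
          * Set.indicator (distinctEvent σ (n + 1)) (fun _ => (1 : ℝ)) ω ∂ℙ
      = (1 - ℙ.real {ω | R 0 1 ω = qk}) * ∫ ω, f (fun i j : Fin n => R i j ω)
          * Set.indicator (distinctEvent σ n) (fun _ => (1 : ℝ)) ω ∂ℙ := by
  set D : Set (Fin n → Fin n → ℝ) := {x | ∀ i j, i ≠ j → x i j ≠ qk} with hD
  have mD : MeasurableSet D := measurableSet_D n qk
  let g : (Fin n → Fin n → ℝ) → ℝ := fun x => f x * D.indicator (fun _ => (1:ℝ)) x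
  have hg : Measurable g := hf.mul (measurable_const.indicator mD)
  obtain ⟨C, hC⟩ := hfb
  have hgb : ∀ x, |g x| ≤ C := by
    intro x
    have h0 := (abs_nonneg _).trans (hC x)
    simp only [g, Set.indicator_apply]
    split_ifs
    · simpa using hC x
    · simpa using h0
  have hgA : ∀ ω, f (fun i j : Fin n => R i j ω)
          * Set.indicator (distinctEvent σ n) (fun _ => (1 : ℝ)) ω
        = g (fun i j : Fin n => R i j ω) := by
    intro ω
    simp only [g]
    congr 1
    by_cases h : ω ∈ distinctEvent σ n
    · rw [Set.indicator_of_mem h, Set.indicator_of_mem ((distinct_iff σ R qk heq n ω).1 h)]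
    · rw [Set.indicator_of_notMem h,
        Set.indicator_of_notMem (fun h' => h ((distinct_iff σ R qk heq n ω).2 h'))]
  have hgD : ∀ x i j, i ≠ j → x i j = qk → g x = 0 := by
    intro x i j hij hx
    have : x ∉ D := fun h => h i j hij hx
    simp [g, this]
  have hp := per_index ℙ R qk hdiag hmeas hexch hGG n hn g hg ⟨C, hgb⟩ hgD
  have hψ : ∫ ω, Set.indicator {qk} (fun _ => (1 : ℝ)) (R 0 1 ω) ∂ℙ
      = ℙ.real {ω | R 0 1 ω = qk} := by
    exact integral_indicator_one (hmeas 0 1 (measurableSet_singleton qk))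
  have hRm : Measurable fun ω => fun i j : Fin n => R i j ω :=
    measurable_pi_lambda _ fun a => measurable_pi_lambda _ fun b => hmeas _ _
  have hgi : Integrable (fun ω => g (fun i j : Fin n => R i j ω)) ℙ :=
    Integrable.of_bound (hg.comp hRm).aestronglyMeasurable C
      (Filter.Eventually.of_forall fun ω => hgb _)
  have hgpi : ∀ i : Fin n, Integrable (fun ω => g (fun i j : Fin n => R i j ω)
      * Set.indicator {qk} (fun _ => (1 : ℝ)) (R i n ω)) ℙ := by
    intro i
    refine hgi.mul_bdd (c := 1) ?_ ?_
    · exact ((measurable_const.indicator (measurableSet_singleton qk)).comp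
        (hmeas i n)).aestronglyMeasurable
    · refine Filter.Eventually.of_forall fun ω => ?_
      rw [Set.indicator_apply]; split_ifs <;> simp
  have hpt : ∀ ω, f (fun i j : Fin n => R i j ω)
          * Set.indicator (distinctEvent σ (n + 1)) (fun _ => (1 : ℝ)) ω
      = g (fun i j : Fin n => R i j ω) - ∑ i : Fin n, g (fun i j : Fin n => R i j ω)
      * Set.indicator {qk} (fun _ => (1 : ℝ)) (R i n ω) := by
    intro ω
    rw [indicator_step σ R qk heq, mul_sub, hgA, Finset.mul_sum]
    simp only [← mul_assoc, hgA]
  simp only [hpt, hgA]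
  rw [integral_sub hgi (integrable_finsetSum _ fun i _ => hgpi i),
    integral_finsetSum _ fun i _ => hgpi i]
  simp only [hp, hψ, Finset.sum_const, Finset.card_univ, Fintype.card_fin, nsmul_eq_mul]
  have : (n : ℝ) ≠ 0 := by positivity
  field_simp

section SeqExt

open ProbabilityTheory Finset Preorder

lemma seq_ext {S : Type*} [MeasurableSpace S] [StandardBorelSpace S] [Nonempty S]
    (ν : ℕ → Measure S) [∀ n, IsProbabilityMeasure (ν n)] (T : ℕ → S → S)
    (hT : ∀ n, Measurable (T n)) (hν : ∀ n, (ν (n + 1)).map (T n) = ν n) :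
    ∃ M : Measure (ℕ → S), IsProbabilityMeasure M ∧ (∀ n, M.map (fun x => x n) = ν n) ∧
      ∀ᵐ x ∂M, ∀ n, T n (x (n + 1)) = x n := by
  let κ : (n : ℕ) → Kernel (Π i : Iic n, (fun _ : ℕ => S) i) ((fun _ : ℕ => S) (n + 1)) := fun n =>
    (condDistrib id (T n) (ν (n + 1))).comap (fun x => x ⟨n, by simp⟩) (measurable_pi_apply _)
  have : ∀ n, IsMarkovKernel (κ n) := fun n => by simp only [κ]; infer_instance
  let M : Measure (ℕ → S) := Kernel.trajMeasure (X := fun _ => S) (ν 0) κ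
  have : IsProbabilityMeasure M := by simp only [M]; infer_instance
  have h0 : M.map (fun x => x 0) = ν 0 := by
    have e : M.map (frestrictLe (π := fun _ => S) 0) = (ν 0).map
        (MeasurableEquiv.piUnique (fun i : Iic 0 => (fun _ : ℕ => S) i)).symm := by
      simp only [M]
      rw [Kernel.trajMeasure, Measure.map_comp _ _ (by fun_prop), Kernel.traj_map_frestrictLe,
        Kernel.partialTraj_self, Measure.id_comp]
    have e2 := congrArg (Measure.map (fun x : (Π i : Iic 0, (fun _ : ℕ => S) i) =>
      x ⟨0, by simp⟩)) e
    rw [Measure.map_map (by fun_prop) (by fun_prop),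
      Measure.map_map (by fun_prop) (by fun_prop)] at e2
    refine Eq.trans ?_ (e2.trans ?_)
    · rfl
    · exact Measure.map_id
  have step : ∀ n, M.map (fun x => x n) = ν n →
      M.map (fun x => (x n, x (n + 1))) = (ν (n + 1)).map (fun y => (T n y, y)) := by
    intro n hn
    have h1 := Kernel.map_frestrictLe_trajMeasure_compProd_eq_map_trajMeasure
      (X := fun _ => S) (μ₀ := ν 0) (κ := κ) (a := n)
    have h2 : (ν (n + 1)).map (fun y => (T n y, y))
        = (ν n) ⊗ₘ condDistrib id (T n) (ν (n + 1)) := by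
      rw [← hν n, compProd_map_condDistrib (by fun_prop)]
      rfl
    rw [h2, ← hn]
    let ev : (Π i : Iic n, (fun _ : ℕ => S) i) → S := fun x => x ⟨n, by simp⟩
    have hev : Measurable ev := measurable_pi_apply _
    have h3 := congrArg (Measure.map (Prod.map ev (id : S → S))) h1
    rw [Measure.map_map (by fun_prop) (by fun_prop)] at h3
    refine Eq.trans (Eq.trans ?_ h3.symm) ?_
    · rfl
    · ext s hs
      rw [Measure.map_apply (by fun_prop) hs,
        Measure.compProd_apply ((hev.prodMap measurable_id) hs), Measure.compProd_apply hs,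
        lintegral_map (Kernel.measurable_kernel_prodMk_left
          ((hev.prodMap measurable_id) hs)) (by fun_prop),
        lintegral_map (Kernel.measurable_kernel_prodMk_left hs) (by fun_prop)]
      rfl
  have marg : ∀ n, M.map (fun x => x n) = ν n := by
    intro n
    induction n with
    | zero => exact h0
    | succ n ih =>
      have := congrArg (Measure.map Prod.snd) (step n ih)
      rw [Measure.map_map (by fun_prop) (by fun_prop), Measure.map_map (by fun_prop)
        (by have := hT n; fun_prop)] at this
      simpa [Function.comp_def] using this
  refine ⟨M, inferInstance, marg, ae_all_iff.2 fun n => ?_⟩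
  have hs := step n (marg n)
  have hset : MeasurableSet {p : S × S | T n p.2 = p.1} :=
    measurableSet_eq_fun ((hT n).comp measurable_snd) measurable_fst
  have : ∀ᵐ p ∂(M.map (fun x => (x n, x (n + 1)))), T n p.2 = p.1 := by
    rw [hs, ae_map_iff (by have := hT n; fun_prop) hset]
    simp
  rwa [ae_map_iff (by fun_prop) hset] at this

end SeqExt

/-- the conditional distributions
`P_n(B) = E[1{Rⁿ ∈ B} 1_{A_n}] / E[1_{A_n}]` form a consistent family, and hence there
exists an infinite random array `Q` (a probability measure on `ℕ → ℕ → ℝ`) whose `n × n`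
marginal is `P_n` for each `n`. -/
theorem conditional_family_consistent_and_extension
    {Ω : Type*} [MeasurableSpace Ω] (ℙ : Measure Ω) [IsProbabilityMeasure ℙ]
    {H : Type*} [NormedAddCommGroup H] [InnerProductSpace ℝ H]
    [MeasurableSpace H] [BorelSpace H]
    (σ : ℕ → Ω → H) (R : ℕ → ℕ → Ω → ℝ) (qk pk : ℝ) (hpk1 : pk < 1)
    (hσ : ∀ l, Measurable (σ l))
    (hR : ∀ l l' ω, R l l' ω = ⟪σ l ω, σ l' ω⟫)
    (hsphere : ∀ l ω, ⟪σ l ω, σ l ω⟫ = qk)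
    (heq : ∀ l l', l ≠ l' → ∀ ω, (R l l' ω = qk ↔ σ l ω = σ l' ω))
    (hmeas : ∀ l l', Measurable (fun ω => R l l' ω))
    (hpk : ℙ {ω | R 0 1 ω = qk} = ENNReal.ofReal pk)
    (hexch : ∀ (m : ℕ) (ρ : Equiv.Perm (Fin m)),
      Measure.map (fun ω => fun i j : Fin m => R (ρ i) (ρ j) ω) ℙ
        = Measure.map (fun ω => fun i j : Fin m => R i j ω) ℙ)
    (hGG : ∀ m, 2 ≤ m → ∀ f : (Fin m → Fin m → ℝ) → ℝ, Measurable f →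
      (∃ C, ∀ x, |f x| ≤ C) → ∀ ψ : ℝ → ℝ, Measurable ψ → (∃ C, ∀ x, |ψ x| ≤ C) →
      ∫ ω, f (fun i j : Fin m => R i j ω) * ψ (R 0 m ω) ∂ℙ
        = (1 / m) * (∫ ω, f (fun i j : Fin m => R i j ω) ∂ℙ)
              * (∫ ω, ψ (R 0 1 ω) ∂ℙ)
          + (1 / m) * ∑ l ∈ Finset.Ico 1 m,
              ∫ ω, f (fun i j : Fin m => R i j ω) * ψ (R 0 l ω) ∂ℙ) :
    (∀ n, 1 ≤ n → ∀ f : (Fin n → Fin n → ℝ) → ℝ, Measurable f →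
      (∃ C, ∀ x, |f x| ≤ C) →
      (∫ ω, f (fun i j : Fin n => R i j ω)
          * Set.indicator (distinctEvent σ (n + 1)) (fun _ => (1 : ℝ)) ω ∂ℙ)
        / (ℙ (distinctEvent σ (n + 1))).toReal
      = (∫ ω, f (fun i j : Fin n => R i j ω)
          * Set.indicator (distinctEvent σ n) (fun _ => (1 : ℝ)) ω ∂ℙ)
        / (ℙ (distinctEvent σ n)).toReal) ∧
    ∃ μ : Measure (ℕ → ℕ → ℝ), IsProbabilityMeasure μ ∧
      ∀ n, Measure.map (fun x => fun i j : Fin n => x i j) μ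
        = (ℙ (distinctEvent σ n))⁻¹
            • Measure.map (fun ω => fun i j : Fin n => R i j ω)
                (ℙ.restrict (distinctEvent σ n)) := by
  classical
  have hdiag : ∀ l ω, R l l ω = qk := fun l ω => (hR l l ω).trans (hsphere l ω)
  have key := key_step ℙ σ R qk heq hdiag hmeas hexch hGG
  set p : ℝ := ℙ.real {ω | R 0 1 ω = qk} with hp
  have hp1 : p < 1 := by
    rw [hp, Measure.real, hpk, ENNReal.toReal_ofReal']
    exact max_lt hpk1 one_pos
  have hRm : ∀ n : ℕ, Measurable fun ω => fun i j : Fin n => R i j ω := fun n =>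
    measurable_pi_lambda _ fun a => measurable_pi_lambda _ fun b => hmeas _ _
  have mA : ∀ n, MeasurableSet (distinctEvent σ n) := by
    intro n
    have : distinctEvent σ n = (fun ω => fun i j : Fin n => R i j ω) ⁻¹'
        {x : Fin n → Fin n → ℝ | ∀ i j, i ≠ j → x i j ≠ qk} := by
      ext ω
      exact distinct_iff σ R qk heq n ω
    rw [this]
    exact hRm n (measurableSet_D n qk)
  have hA1 : ∀ n, n ≤ 1 → distinctEvent σ n = Set.univ := by
    intro n hn
    ext ω
    simp only [distinctEvent, Set.mem_univ, iff_true]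
    intro i j hi hj hij
    omega
  have hAs : ∀ n, 1 ≤ n →
      ℙ.real (distinctEvent σ (n + 1)) = (1 - p) * ℙ.real (distinctEvent σ n) := by
    intro n hn
    have h := key n hn (fun _ => 1) measurable_const ⟨1, fun _ => by simp⟩
    simp only [one_mul] at h
    have e : ∀ m, ∫ ω, Set.indicator (distinctEvent σ m) (fun _ => (1 : ℝ)) ω ∂ℙ
        = ℙ.real (distinctEvent σ m) := fun m => integral_indicator_one (mA m)
    rw [e, e] at h
    exact h
  have hApos' : ∀ n, 0 < ℙ.real (distinctEvent σ (n + 1)) := by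
    intro n
    induction n with
    | zero => rw [hA1 _ le_rfl]; simp
    | succ n ih => rw [hAs _ (by omega)]; exact mul_pos (by linarith) ih
  have hApos : ∀ n, 0 < ℙ.real (distinctEvent σ n) := by
    intro n
    cases n with
    | zero => rw [hA1 _ (by omega)]; simp
    | succ n => exact hApos' n
  have part1 : ∀ n, 1 ≤ n → ∀ f : (Fin n → Fin n → ℝ) → ℝ, Measurable f →
      (∃ C, ∀ x, |f x| ≤ C) →
      (∫ ω, f (fun i j : Fin n => R i j ω)
          * Set.indicator (distinctEvent σ (n + 1)) (fun _ => (1 : ℝ)) ω ∂ℙ)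
        / (ℙ (distinctEvent σ (n + 1))).toReal
      = (∫ ω, f (fun i j : Fin n => R i j ω)
          * Set.indicator (distinctEvent σ n) (fun _ => (1 : ℝ)) ω ∂ℙ)
        / (ℙ (distinctEvent σ n)).toReal := by
    intro n hn f hf hfb
    rw [key n hn f hf hfb]
    have h1 := hAs n hn
    simp only [Measure.real] at h1
    rw [h1]
    exact mul_div_mul_left _ _ (by linarith)
  refine ⟨part1, ?_⟩
  have hc : ∀ n, IsProbabilityMeasure (ProbabilityTheory.cond ℙ (distinctEvent σ n)) := by
    intro n
    apply ProbabilityTheory.cond_isProbabilityMeasure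
    intro h
    have := hApos n
    simp [Measure.real, h] at this
  -- truncated arrays
  let Y : ℕ → Ω → ℕ → ℕ → ℝ := fun n ω i j => if i < n ∧ j < n then R i j ω else 0
  let T : ℕ → (ℕ → ℕ → ℝ) → ℕ → ℕ → ℝ := fun n x i j => if i < n ∧ j < n then x i j else 0
  have hY : ∀ n, Measurable (Y n) := by
    intro n
    refine measurable_pi_lambda _ fun a => measurable_pi_lambda _ fun b => ?_
    by_cases h : a < n ∧ b < n
    · simpa only [Y, if_pos h] using hmeas a b
    · simp only [Y, if_neg h]; exact measurable_const
  have hT : ∀ n, Measurable (T n) := by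
    intro n
    refine measurable_pi_lambda _ fun a => measurable_pi_lambda _ fun b => ?_
    by_cases h : a < n ∧ b < n
    · simp only [T, if_pos h]; fun_prop
    · simp only [T, if_neg h]; exact measurable_const
  have hTY : ∀ n, T n ∘ Y (n + 1) = Y n := by
    intro n
    funext ω i j
    simp only [Function.comp, T, Y]
    split_ifs <;> first | rfl | omega
  let ν : ℕ → Measure (ℕ → ℕ → ℝ) := fun n =>
    (ProbabilityTheory.cond ℙ (distinctEvent σ n)).map (Y n)
  have hνp : ∀ n, IsProbabilityMeasure (ν n) := fun n =>
    Measure.isProbabilityMeasure_map (hY n).aemeasurable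
  have hν : ∀ n, (ν (n + 1)).map (T n) = ν n := by
    intro n
    simp only [ν]
    rw [Measure.map_map (hT n) (hY _), hTY]
    rcases Nat.eq_zero_or_pos n with rfl | hn
    · rw [hA1 _ (by omega), hA1 _ (by omega)]
    · ext B hB
      rw [Measure.map_apply (hY n) hB, Measure.map_apply (hY n) hB]
      let E : (Fin n → Fin n → ℝ) → ℕ → ℕ → ℝ := fun x i j =>
        if h : i < n ∧ j < n then x ⟨i, h.1⟩ ⟨j, h.2⟩ else 0
      have hE : Measurable E := by
        refine measurable_pi_lambda _ fun a => measurable_pi_lambda _ fun b => ?_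
        by_cases h : a < n ∧ b < n
        · simp only [E, dif_pos h]; fun_prop
        · simp only [E, dif_neg h]; exact measurable_const
      have hEY : ∀ ω, E (fun i j : Fin n => R i j ω) = Y n ω := by
        intro ω
        funext i j
        simp only [E, Y]
        split_ifs <;> rfl
      have h := part1 n hn ((E ⁻¹' B).indicator fun _ => 1)
        (measurable_const.indicator (hE hB))
        ⟨1, fun x => by rw [Set.indicator_apply]; split_ifs <;> simp⟩
      have e : ∀ m, ∫ ω, (E ⁻¹' B).indicator (fun _ => (1 : ℝ)) (fun i j : Fin n => R i j ω)
          * Set.indicator (distinctEvent σ m) (fun _ => (1 : ℝ)) ω ∂ℙ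
          = ℙ.real (distinctEvent σ m ∩ Y n ⁻¹' B) := by
        intro m
        rw [← integral_indicator_one ((mA m).inter (hY n hB))]
        congr 1
        funext ω
        by_cases h1 : Y n ω ∈ B <;> by_cases h2 : ω ∈ distinctEvent σ m <;>
          simp [hEY, h1, h2]
      rw [e, e] at h
      rw [← ENNReal.toReal_eq_toReal_iff' (measure_ne_top _ _) (measure_ne_top _ _),
        ProbabilityTheory.cond_apply (mA _), ProbabilityTheory.cond_apply (mA _),
        ENNReal.toReal_mul, ENNReal.toReal_mul, ENNReal.toReal_inv, ENNReal.toReal_inv]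
      simpa only [Measure.real, div_eq_inv_mul] using h
  obtain ⟨M, hM, hmarg, hcons⟩ := seq_ext ν T hT hν
  let Q : (ℕ → ℕ → ℕ → ℝ) → ℕ → ℕ → ℝ := fun x i j => x (max i j + 1) i j
  have hQ : Measurable Q :=
    measurable_pi_lambda _ fun a => measurable_pi_lambda _ fun b => by fun_prop
  refine ⟨M.map Q, Measure.isProbabilityMeasure_map hQ.aemeasurable, fun n => ?_⟩
  have hres : Measurable fun x : ℕ → ℕ → ℝ => fun i j : Fin n => x i j :=
    measurable_pi_lambda _ fun a => measurable_pi_lambda _ fun b => by fun_prop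
  have hae : (fun x : ℕ → ℕ → ℕ → ℝ => fun i j : Fin n => Q x i j)
      =ᵐ[M] fun x => fun i j : Fin n => x n i j := by
    filter_upwards [hcons] with x hx
    funext i j
    have : ∀ m, max (i : ℕ) j + 1 ≤ m → x (max (i : ℕ) j + 1) i j = x m i j := by
      intro m hm
      induction m, hm using Nat.le_induction with
      | base => rfl
      | succ m hm ih =>
        rw [ih, ← hx m]
        simp only [T]
        rw [if_pos]
        omega
    exact this n (by have := i.2; have := j.2; omega)
  rw [Measure.map_map hres hQ]
  refine (Measure.map_congr hae).trans ?_
  have h1 : M.map (fun x => fun i j : Fin n => x n i j)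
      = (M.map (fun x => x n)).map (fun x : ℕ → ℕ → ℝ => fun i j : Fin n => x i j) := by
    rw [Measure.map_map hres (by fun_prop)]
    rfl
  rw [h1, hmarg]
  simp only [ν]
  rw [Measure.map_map hres (hY n)]
  have h2 : (fun x : ℕ → ℕ → ℝ => fun i j : Fin n => x i j) ∘ Y n
      = fun ω => fun i j : Fin n => R i j ω := by
    funext ω i j
    simp [Y]
  rw [h2, ProbabilityTheory.cond, Measure.map_smul]
end

section
/- Let R be a symmetric, positive semidefinite, weakly exchangeable random array with R_{l,l}=1, whose off-diagonal entries take finitely many values q_1 < ... < q_k with q_1 ≥ 0, and which satisfies the Ghirlanda–Guerra identities. Then R is ultrametric: P(R_{2,3} ≥ min(R_{1,2}, R_{1,3})) = 1. -/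
open MeasureTheory

abbrev Arr := ℕ → ℕ → ℝ

/-- The set `S` of arrays only depends on the first `M` rows and columns. -/
def Dep (M : ℕ) (S : Set Arr) : Prop :=
  ∀ A A' : Arr, (∀ i < M, ∀ j < M, A i j = A' i j) → A ∈ S → A' ∈ S

def extArr (M : ℕ) (x : Fin M → Fin M → ℝ) : Arr :=
  fun i j => if h : i < M ∧ j < M then x ⟨i, h.1⟩ ⟨j, h.2⟩ else 0

lemma measurable_extArr (M : ℕ) : Measurable (extArr M) := by
  refine measurable_pi_lambda _ fun i => measurable_pi_lambda _ fun j => ?_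
  unfold extArr
  by_cases h : i < M ∧ j < M
  · simp only [h, and_self, dite_true]; fun_prop
  · simp only [h, dite_false]; fun_prop

lemma Dep.iff {M : ℕ} {S : Set Arr} (h : Dep M S) {A A' : Arr}
    (hA : ∀ i < M, ∀ j < M, A i j = A' i j) : A ∈ S ↔ A' ∈ S :=
  ⟨h A A' hA, h A' A fun i hi j hj => (hA i hi j hj).symm⟩

lemma Dep.ext_iff {M : ℕ} {S : Set Arr} (h : Dep M S) (A : Arr) :
    extArr M (fun i j => A i j) ∈ S ↔ A ∈ S :=
  h.iff fun i hi j hj => by simp [extArr, hi, hj]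

def swapArr (a b : ℕ) (A : Arr) : Arr := fun i j => A (Equiv.swap a b i) (Equiv.swap a b j)

lemma measurable_swapArr (a b : ℕ) : Measurable (swapArr a b) := by
  unfold swapArr; fun_prop

def Exch (μ : Measure Arr) : Prop := ∀ M, ∀ a < M, ∀ b < M, ∀ S : Set Arr, MeasurableSet S →
  Dep M S → μ (swapArr a b ⁻¹' S) = μ S

def GG0 (μ : Measure Arr) : Prop := ∀ N, 2 ≤ N → ∀ S : Set Arr, MeasurableSet S → Dep N S →
  ∀ y : ℝ, (∀ A ∈ S, ∀ l < N, l ≠ 0 → A 0 l ≤ y) →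
  ((N : ℝ) - 1) * μ.real S ≤ N * μ.real (S ∩ {A | A 0 N ≤ y})

lemma meas_arr {Ω : Type*} [MeasurableSpace Ω] {R : ℕ → ℕ → Ω → ℝ}
    (hmeas : ∀ l l', Measurable (fun ω => R l l' ω)) :
    Measurable (fun ω => (fun i j => R i j ω : Arr)) :=
  measurable_pi_lambda _ fun i => measurable_pi_lambda _ fun j => hmeas i j

lemma exch_of {Ω : Type*} [MeasurableSpace Ω] (ℙ : Measure Ω)
    (R : ℕ → ℕ → Ω → ℝ)
    (hmeas : ∀ l l', Measurable (fun ω => R l l' ω))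
    (hexch : ∀ (m : ℕ) (ρ : Equiv.Perm (Fin m)),
      Measure.map (fun ω => fun i j : Fin m => R (ρ i) (ρ j) ω) ℙ
        = Measure.map (fun ω => fun i j : Fin m => R i j ω) ℙ) :
    Exch (ℙ.map (fun ω => (fun i j => R i j ω : Arr))) := by
  intro M a ha b hb S hS hd
  rw [Measure.map_apply (meas_arr hmeas) (measurable_swapArr a b hS),
    Measure.map_apply (meas_arr hmeas) hS]
  have h := congrArg (fun ν => ν (extArr M ⁻¹' S)) (hexch M (Equiv.swap ⟨a, ha⟩ ⟨b, hb⟩))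
  rw [Measure.map_apply (measurable_pi_lambda _ fun i => measurable_pi_lambda _ fun j => hmeas _ _)
      (measurable_extArr M hS),
    Measure.map_apply (measurable_pi_lambda _ fun i => measurable_pi_lambda _ fun j => hmeas _ _)
      (measurable_extArr M hS)] at h
  convert h using 2
  · ext ω
    simp only [Set.mem_preimage]
    apply hd.iff
    intro i hi j hj
    have key : ∀ i (hi : i < M), ((Equiv.swap (⟨a, ha⟩ : Fin M) ⟨b, hb⟩ ⟨i, hi⟩ : Fin M) : ℕ)
        = Equiv.swap a b i := by
      intro i hi
      simp only [Equiv.swap_apply_def, Fin.mk.injEq]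
      split_ifs <;> rfl
    simp [extArr, hi, hj, swapArr, key]
  · ext ω
    simp only [Set.mem_preimage]
    exact (hd.ext_iff (fun i j => R i j ω)).symm

lemma gg0_of {Ω : Type*} [MeasurableSpace Ω] (ℙ : Measure Ω) [IsProbabilityMeasure ℙ]
    (R : ℕ → ℕ → Ω → ℝ)
    (hmeas : ∀ l l', Measurable (fun ω => R l l' ω))
    (hGG : ∀ m, 2 ≤ m → ∀ f : (Fin m → Fin m → ℝ) → ℝ, Measurable f →
      (∃ C, ∀ x, |f x| ≤ C) → ∀ ψ : ℝ → ℝ, Measurable ψ → (∃ C, ∀ x, |ψ x| ≤ C) →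
      ∫ ω, f (fun i j : Fin m => R i j ω) * ψ (R 0 m ω) ∂ℙ
        = (1 / m) * (∫ ω, f (fun i j : Fin m => R i j ω) ∂ℙ)
              * (∫ ω, ψ (R 0 1 ω) ∂ℙ)
          + (1 / m) * ∑ l ∈ Finset.Ico 1 m,
              ∫ ω, f (fun i j : Fin m => R i j ω) * ψ (R 0 l ω) ∂ℙ) :
    GG0 (ℙ.map (fun ω => (fun i j => R i j ω : Arr))) := by
  classical
  intro N hN S hS hd y hy
  have hm := meas_arr hmeas
  have hU : MeasurableSet {A : Arr | A 0 N ≤ y} :=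
    measurableSet_le (by fun_prop) measurable_const
  rw [map_measureReal_apply hm hS, map_measureReal_apply hm (hS.inter hU)]
  set E := (fun ω => (fun i j => R i j ω : Arr)) ⁻¹' S with hE
  have hEm : MeasurableSet E := hm hS
  have hEd : ∀ ω, extArr N (fun i j => R i j ω) ∈ S ↔ ω ∈ E := fun ω =>
    hd.ext_iff (fun i j => R i j ω)
  have h := hGG N hN ((extArr N ⁻¹' S).indicator 1)
    (measurable_one.indicator (measurable_extArr N hS))
    ⟨1, fun x => by by_cases hx : x ∈ extArr N ⁻¹' S <;> simp [hx]⟩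
    ((Set.Iic y).indicator 1) (measurable_one.indicator measurableSet_Iic)
    ⟨1, fun x => by by_cases hx : x ∈ Set.Iic y <;> simp [hx]⟩
  have e1 : ∀ ω, (extArr N ⁻¹' S).indicator (1 : (Fin N → Fin N → ℝ) → ℝ) (fun i j : Fin N => R i j ω)
      = E.indicator 1 ω := by
    intro ω
    simp only [Set.indicator_apply, Set.mem_preimage, hEd, Pi.one_apply]
  have e2 : ∀ l ∈ Finset.Ico 1 N, ∫ ω, (extArr N ⁻¹' S).indicator (1 : (Fin N → Fin N → ℝ) → ℝ)
      (fun i j : Fin N => R i j ω) * (Set.Iic y).indicator 1 (R 0 l ω) ∂ℙ = ℙ.real E := by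
    intro l hl
    rw [Finset.mem_Ico] at hl
    rw [← integral_indicator_one hEm]
    congr 1; ext ω
    rw [e1]
    by_cases hω : ω ∈ E
    · have := hy _ hω l hl.2 (by omega)
      simp [hω, this]
    · simp [hω]
  have e3 : ∫ ω, (extArr N ⁻¹' S).indicator (1 : (Fin N → Fin N → ℝ) → ℝ)
      (fun i j : Fin N => R i j ω) * (Set.Iic y).indicator 1 (R 0 N ω) ∂ℙ
      = ℙ.real (((fun ω => (fun i j => R i j ω : Arr)) ⁻¹' (S ∩ {A : Arr | A 0 N ≤ y}))) := by
    rw [← integral_indicator_one (hm (hS.inter hU))]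
    congr 1; ext ω
    rw [e1]
    simp only [Set.indicator_apply, Set.preimage_inter, Set.mem_inter_iff, ← hE, Pi.one_apply,
      Set.mem_Iic, Set.mem_preimage, Set.mem_ofPred_eq]
    split_ifs <;> simp_all
  rw [e3, Finset.sum_congr rfl e2] at h
  simp only [e1] at h
  rw [integral_indicator_one hEm] at h
  have hpos : 0 ≤ ∫ ω, (Set.Iic y).indicator (1 : ℝ → ℝ) (R 0 1 ω) ∂ℙ :=
    integral_nonneg fun ω => Set.indicator_nonneg (fun _ _ => zero_le_one) _
  have hN0 : (0 : ℝ) < N := by positivity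
  have h1 : (N : ℝ) * ℙ.real (((fun ω => (fun i j => R i j ω : Arr)) ⁻¹'
      (S ∩ {A : Arr | A 0 N ≤ y}))) = ℙ.real E *
      (∫ ω, (Set.Iic y).indicator (1 : ℝ → ℝ) (R 0 1 ω) ∂ℙ) + (N - 1) * ℙ.real E := by
    rw [h]
    simp only [Finset.sum_const, Nat.card_Ico, nsmul_eq_mul]
    rw [Nat.cast_sub (by omega)]
    field_simp
    push_cast; ring
  rw [h1]
  have := mul_nonneg (measureReal_nonneg (μ := ℙ) (s := E)) hpos
  linarith

lemma Exch.real {μ : Measure Arr} (h : Exch μ) {M a b : ℕ} (ha : a < M) (hb : b < M)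
    {S : Set Arr} (hS : MeasurableSet S) (hd : Dep M S) :
    μ.real (swapArr a b ⁻¹' S) = μ.real S := by
  simp only [measureReal_def, h M a ha b hb S hS hd]

lemma Dep.swap {M a b : ℕ} (ha : a < M) (hb : b < M) {S : Set Arr} (hd : Dep M S) :
    Dep M (swapArr a b ⁻¹' S) := by
  intro A A' h hA
  refine hd _ _ (fun i hi j hj => ?_) hA
  have : ∀ i < M, Equiv.swap a b i < M := by
    intro i hi; rw [Equiv.swap_apply_def]; split_ifs <;> assumption
  exact h _ (this i hi) _ (this j hj)

lemma Dep.mono {M M' : ℕ} (h : M ≤ M') {S : Set Arr} (hd : Dep M S) : Dep M' S :=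
  fun A A' hA => hd A A' fun i hi j hj => hA i (hi.trans_le h) j (hj.trans_le h)

lemma swapArr_swapArr (a b : ℕ) (A : Arr) : swapArr a b (swapArr a b A) = A := by
  ext i j; simp [swapArr]

/-- Ghirlanda-Guerra inequality with a general distinguished index. -/
lemma GGs {μ : Measure Arr} (hG : GG0 μ) (hE : Exch μ) {N s : ℕ} (hN : 2 ≤ N) (hs : s < N)
    {S : Set Arr} (hS : MeasurableSet S) (hd : Dep N S) {y : ℝ}
    (hy : ∀ A ∈ S, ∀ l < N, l ≠ s → A s l ≤ y) :
    ((N : ℝ) - 1) * μ.real S ≤ N * μ.real (S ∩ {A | A s N ≤ y}) := by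
  have h := hG N hN (swapArr 0 s ⁻¹' S) (measurable_swapArr _ _ hS)
    (hd.swap (by omega) hs) y ?_
  · rw [hE.real (M := N) (by omega) hs hS hd] at h
    have hU : MeasurableSet (S ∩ {A : Arr | A s N ≤ y}) :=
      hS.inter (measurableSet_le (by fun_prop) measurable_const)
    have h2 := hE.real (M := N + 1) (a := 0) (b := s) (by omega) (by omega) hU ?_
    · rw [← h2]
      convert h using 4
      ext A
      have : Equiv.swap 0 s N = N := Equiv.swap_apply_of_ne_of_ne (by omega) (by omega)
      simp [swapArr, this]
    · intro A A' hA ⟨h1, h2⟩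
      refine ⟨hd.mono (Nat.le_succ N) A A' hA h1, ?_⟩
      simp only [Set.mem_ofPred_eq] at h2 ⊢
      rw [← hA s (by omega) N (by omega)]; exact h2
  · intro A hA l hl hl0
    have := hy _ hA (Equiv.swap 0 s l) (by rw [Equiv.swap_apply_def]; split_ifs <;> omega)
      (by rw [Equiv.swap_apply_def]; split_ifs <;> omega)
    simpa [swapArr] using this

lemma dup {μ : Measure Arr} [IsProbabilityMeasure μ] (hG : GG0 μ) (hE : Exch μ) {N s : ℕ}
    (hN : 2 ≤ N) (hs : s < N) (y : ℝ) (B : Set Arr) (hB : MeasurableSet B)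
    (hBd : ∀ A A' : Arr, (∀ i < N, ∀ j < N, i ≠ s → j ≠ s → A i j = A' i j) → A ∈ B → A' ∈ B)
    (T : ℕ → Set ℝ) (hT : ∀ l, MeasurableSet (T l)) (hTy : ∀ l < N, l ≠ s → T l ⊆ Set.Iic y)
    (hpos : μ {A | A ∈ B ∧ ∀ l < N, l ≠ s → A s l ∈ T l} ≠ 0) :
    μ {A | A ∈ B ∧ (∀ l < N, l ≠ s → A s l ∈ T l) ∧ (∀ l < N, l ≠ s → A N l ∈ T l) ∧
      A s N ≤ y} ≠ 0 := by
  intro h0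
  have hDm : ∀ i, MeasurableSet {A : Arr | ∀ l < N, l ≠ s → A i l ∈ T l} := by
    intro i
    have : {A : Arr | ∀ l < N, l ≠ s → A i l ∈ T l}
        = ⋂ l, ⋂ (_ : l < N), ⋂ (_ : l ≠ s), (fun A : Arr => A i l) ⁻¹' T l := by
      ext A; simp
    rw [this]
    exact MeasurableSet.iInter fun l => MeasurableSet.iInter fun _ => MeasurableSet.iInter fun _ =>
      (show Measurable fun A : Arr => A i l by fun_prop) (hT l)
  have hym : ∀ i j, MeasurableSet {A : Arr | A i j ≤ y} := fun i j =>
    measurableSet_le (by fun_prop) measurable_const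
  set D : ℕ → Set Arr := fun i => {A : Arr | ∀ l < N, l ≠ s → A i l ∈ T l} with hD
  have swapD : ∀ a b i (A : Arr), (a = s ∨ N ≤ a) → N ≤ b →
      (swapArr a b A ∈ D i ↔ A ∈ D (Equiv.swap a b i)) := by
    intro a b i A ha hb
    simp only [hD, Set.mem_ofPred_eq, swapArr]
    refine forall_congr' fun l => forall_congr' fun hl => forall_congr' fun hls => ?_
    rw [Equiv.swap_apply_of_ne_of_ne (a := a) (b := b) (x := l) (by omega) (by omega)]
  have swapB : ∀ a b (A : Arr), (a = s ∨ N ≤ a) → N ≤ b → (swapArr a b A ∈ B ↔ A ∈ B) := by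
    intro a b A ha hb
    have : ∀ i < N, ∀ j < N, i ≠ s → j ≠ s → swapArr a b A i j = A i j := by
      intro i hi j hj his hjs
      simp only [swapArr]
      rw [Equiv.swap_apply_of_ne_of_ne (a := a) (b := b) (x := i) (by omega) (by omega),
        Equiv.swap_apply_of_ne_of_ne (a := a) (b := b) (x := j) (by omega) (by omega)]
    exact ⟨hBd _ _ this, hBd _ _ fun i hi j hj h1 h2 => (this i hi j hj h1 h2).symm⟩
  have depB : ∀ M, N ≤ M → ∀ A A' : Arr, (∀ i < M, ∀ j < M, A i j = A' i j) → A ∈ B → A' ∈ B :=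
    fun M hM A A' h => hBd A A' fun i hi j hj _ _ => h i (by omega) j (by omega)
  have depD : ∀ M i, N ≤ M → i < M → ∀ A A' : Arr, (∀ i < M, ∀ j < M, A i j = A' i j) →
      (A ∈ D i ↔ A' ∈ D i) := by
    intro M i hM hi A A' h
    simp only [hD, Set.mem_ofPred_eq]
    refine forall_congr' fun l => forall_congr' fun hl => forall_congr' fun hls => ?_
    rw [h i hi l (by omega)]
  -- the null events
  have hnull : ∀ j, μ (B ∩ D s ∩ D (N + j) ∩ {A | A s (N + j) ≤ y}) = 0 := by
    intro j
    have h1 := hE (N + j + 1) N (by omega) (N + j) (by omega)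
      (B ∩ D s ∩ D N ∩ {A | A s N ≤ y}) (((hB.inter (hDm s)).inter (hDm N)).inter (hym _ _)) ?_
    · have h2 : μ (B ∩ D s ∩ D N ∩ {A | A s N ≤ y}) = 0 := by
        rw [← h0]; congr 1; ext A; simp only [hD, Set.mem_inter_iff, Set.mem_ofPred_eq]; tauto
      rw [h2] at h1
      rw [← h1]; congr 1; ext A
      have e1 := swapB N (N + j) A (Or.inr le_rfl) (by omega)
      have e2 := swapD N (N + j) s A (Or.inr le_rfl) (by omega)
      have e3 := swapD N (N + j) N A (Or.inr le_rfl) (by omega)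
      have es : Equiv.swap N (N + j) s = s :=
        Equiv.swap_apply_of_ne_of_ne (by omega) (by omega)
      rw [es] at e2
      rw [Equiv.swap_apply_left] at e3
      simp only [Set.mem_inter_iff, Set.mem_preimage, e1, e2, e3]
      simp [swapArr, es]
    · intro A A' hA ⟨⟨⟨a1, a2⟩, a3⟩, a4⟩
      refine ⟨⟨⟨depB _ (by omega) A A' hA a1, (depD _ s (by omega) (by omega) A A' hA).1 a2⟩,
        (depD _ N (by omega) (by omega) A A' hA).1 a3⟩, ?_⟩
      simp only [Set.mem_ofPred_eq] at a4 ⊢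
      rw [← hA s (by omega) N (by omega)]; exact a4
  let U : ℕ → Set Arr := fun m => B ∩ D s ∩ {A | ∀ j < m, A s (N + j) ≤ y}
  let V : ℕ → Set Arr := fun m => B ∩ D s ∩ {A | ∀ j < m, A ∉ D (N + j)}
  let V' : ℕ → Set Arr := fun m => B ∩ D (N + m) ∩ {A | ∀ j < m, A ∉ D (N + j)}
  have hUm : ∀ m, MeasurableSet (U m) := by
    intro m
    refine (hB.inter (hDm s)).inter ?_
    have : {A : Arr | ∀ j < m, A s (N + j) ≤ y} = ⋂ j, ⋂ (_ : j < m), {A | A s (N + j) ≤ y} := by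
      ext A; simp
    rw [this]
    exact MeasurableSet.iInter fun j => MeasurableSet.iInter fun _ => hym _ _
  have hndm : ∀ m, MeasurableSet {A : Arr | ∀ j < m, A ∉ D (N + j)} := by
    intro m
    have : {A : Arr | ∀ j < m, A ∉ D (N + j)} = ⋂ j, ⋂ (_ : j < m), (D (N + j))ᶜ := by
      ext A; simp
    rw [this]
    exact MeasurableSet.iInter fun j => MeasurableSet.iInter fun _ => (hDm _).compl
  have hV'm : ∀ m, MeasurableSet (V' m) := fun m => (hB.inter (hDm _)).inter (hndm m)
  have hUV : ∀ m, μ.real (U m) ≤ μ.real (V m) := by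
    intro m
    refine ENNReal.toReal_mono (measure_ne_top _ _) (measure_mono_ae ?_)
    have : ∀ᵐ A ∂μ, ∀ j, A ∉ B ∩ D s ∩ D (N + j) ∩ {A | A s (N + j) ≤ y} :=
      ae_all_iff.2 fun j => measure_eq_zero_iff_ae_notMem.1 (hnull j)
    filter_upwards [this] with A hA
    rintro ⟨⟨a1, a2⟩, a3⟩
    exact ⟨⟨a1, a2⟩, fun j hj hc => hA j ⟨⟨⟨a1, a2⟩, hc⟩, a3 j hj⟩⟩
  have hVV' : ∀ m, μ.real (V m) = μ.real (V' m) := by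
    intro m
    rw [← hE.real (M := N + m + 1) (a := s) (b := N + m) (by omega) (by omega) (hV'm m) ?_]
    · congr 1; ext A
      have e1 := swapB s (N + m) A (Or.inl rfl) (by omega)
      have e2 := swapD s (N + m) (N + m) A (Or.inl rfl) (by omega)
      rw [Equiv.swap_apply_right] at e2
      have e3 : ∀ j < m, (swapArr s (N + m) A ∈ D (N + j) ↔ A ∈ D (N + j)) := by
        intro j hj
        rw [swapD s (N + m) (N + j) A (Or.inl rfl) (by omega),
          Equiv.swap_apply_of_ne_of_ne (by omega) (by omega)]
      simp only [V, V', Set.mem_inter_iff, Set.mem_preimage, e1, e2, Set.mem_ofPred_eq]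
      refine and_congr_right fun _ => forall_congr' fun j => forall_congr' fun hj => ?_
      rw [e3 j hj]
    · intro A A' hA ⟨⟨a1, a2⟩, a3⟩
      exact ⟨⟨depB _ (by omega) A A' hA a1, (depD _ _ (by omega) (by omega) A A' hA).1 a2⟩,
        fun j hj => by rw [← depD _ _ (by omega) (by omega) A A' hA]; exact a3 j hj⟩
  have hdisj : Pairwise (Function.onFun Disjoint V') := by
    have key : ∀ m m', m < m' → Disjoint (V' m) (V' m') := by
      intro m m' hm
      rw [Set.disjoint_left]
      rintro A ⟨⟨_, a2⟩, _⟩ ⟨_, a3⟩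
      exact a3 m hm a2
    intro m m' hne
    rcases lt_or_gt_of_ne hne with h | h
    · exact key _ _ h
    · exact (key _ _ h).symm
  have hsum : Summable fun m => μ.real (V' m) := by
    have : ∑' m, μ (V' m) ≠ ⊤ := by
      rw [← measure_iUnion hdisj hV'm]; exact measure_ne_top _ _
    exact ENNReal.summable_toReal this
  have hsumU : Summable fun m => μ.real (U m) :=
    Summable.of_nonneg_of_le (fun _ => measureReal_nonneg)
      (fun m => (hUV m).trans (hVV' m).le) hsum
  have hrec : ∀ m : ℕ, ((N : ℝ) + m - 1) * μ.real (U m) ≤ (N + m) * μ.real (U (m + 1)) := by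
    intro m
    have h := GGs hG hE (N := N + m) (s := s) (by omega) (by omega) (hUm m) (y := y) ?_ ?_
    · have e : U m ∩ {A | A s (N + m) ≤ y} = U (m + 1) := by
        ext A
        simp only [U, Set.mem_inter_iff, Set.mem_ofPred_eq, Nat.lt_succ_iff_lt_or_eq, and_assoc]
        constructor
        · rintro ⟨a, b, c, d⟩
          refine ⟨a, b, fun j hj => ?_⟩
          rcases hj with hj | rfl
          · exact c j hj
          · exact d
        · rintro ⟨a, b, c⟩
          exact ⟨a, b, fun j hj => c j (Or.inl hj), c m (Or.inr rfl)⟩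
      rw [e] at h
      push_cast at h
      exact h
    · intro A A' hA ⟨⟨a1, a2⟩, a3⟩
      refine ⟨⟨depB _ (by omega) A A' hA a1, (depD _ _ (by omega) (by omega) A A' hA).1 a2⟩,
        fun j hj => ?_⟩
      rw [← hA s (by omega) (N + j) (by omega)]; exact a3 j hj
    · rintro A ⟨⟨a1, a2⟩, a3⟩ l hl hls
      rcases lt_or_ge l N with h | h
      · exact hTy l h hls (a2 l h hls)
      · obtain ⟨j, rfl⟩ := Nat.exists_eq_add_of_le h
        exact a3 j (by omega)
  have hN' : (2 : ℝ) ≤ N := by exact_mod_cast hN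
  have hlow : ∀ m : ℕ, ((N : ℝ) - 1) * μ.real (U 0) ≤ ((N : ℝ) + m - 1) * μ.real (U m) := by
    intro m
    induction m with
    | zero => simp
    | succ m ih =>
      refine ih.trans ((hrec m).trans (le_of_eq ?_))
      push_cast; ring
  have hU0 : 0 < μ.real (U 0) := by
    have : U 0 = {A | A ∈ B ∧ ∀ l < N, l ≠ s → A s l ∈ T l} := by
      ext A; simp [U, hD]
    rw [this]
    exact ENNReal.toReal_pos hpos (measure_ne_top _ _)
  have hc : 0 < ((N : ℝ) - 1) * μ.real (U 0) := mul_pos (by linarith) hU0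
  have hdiv : Summable fun m : ℕ => 1 / ((m + N : ℕ) : ℝ) := by
    refine Summable.of_nonneg_of_le (fun _ => by positivity) (fun m => ?_)
      (hsumU.mul_left (((N : ℝ) - 1) * μ.real (U 0))⁻¹)
    rw [inv_mul_eq_div, div_le_div_iff₀ (by positivity) hc, one_mul]
    refine (hlow m).trans ?_
    push_cast
    have := measureReal_nonneg (μ := μ) (s := U m)
    nlinarith
  exact Real.not_summable_one_div_natCast
    ((summable_nat_add_iff (f := fun n : ℕ => 1 / (n : ℝ)) N).1 hdiv)

/-- Colours of the replicas. -/
def wcol : ℕ → ℤ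
  | 0 => 1
  | 1 => 0
  | n + 2 => if n % 2 = 0 then -1 else 1

/-- Allowed overlaps between colours. -/
def tau (x y z : ℝ) (a b : ℤ) : Set ℝ :=
  if a = b then Set.Iic y else if a + b = 0 then {y} else if a + b = 1 then {x} else {z}

lemma tau_meas (x y z : ℝ) (a b : ℤ) : MeasurableSet (tau x y z a b) := by
  unfold tau; split_ifs <;> measurability

lemma tau_comm (x y z : ℝ) (a b : ℤ) : tau x y z a b = tau x y z b a := by
  unfold tau; simp only [add_comm a b, eq_comm (a := a) (b := b)]

lemma tau_sub {x y z : ℝ} (hxy : x ≤ y) (hzy : z ≤ y) (a b : ℤ) :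
    tau x y z a b ⊆ Set.Iic y := by
  unfold tau; split_ifs <;> simp [hxy, hzy]

def Pat (x y z : ℝ) (N : ℕ) : Set Arr :=
  {A | ∀ i < N, ∀ j < N, i ≠ j → A i j ∈ tau x y z (wcol i) (wcol j)}

lemma pat_step {μ : Measure Arr} [IsProbabilityMeasure μ] (hG : GG0 μ) (hE : Exch μ)
    (hsym : ∀ᵐ A ∂μ, ∀ i j, A i j = A j i)
    {x y z : ℝ} (hxy : x ≤ y) (hzy : z ≤ y) {N : ℕ} (hN : 3 ≤ N) (h : μ (Pat x y z N) ≠ 0) :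
    μ (Pat x y z (N + 1)) ≠ 0 := by
  obtain ⟨s, hs3, hsw⟩ : ∃ s, s < 3 ∧ wcol s = wcol N := by
    obtain ⟨n, rfl⟩ := Nat.exists_eq_add_of_le' (show 2 ≤ N by omega)
    by_cases hn : n % 2 = 0
    · exact ⟨2, by omega, by simp [wcol, hn]⟩
    · exact ⟨0, by omega, by simp [wcol, hn]⟩
  have hs : s < N := by omega
  have key := dup hG hE (N := N) (s := s) (by omega) hs y
    {A | ∀ i, ∀ j, i < N → j < N → i ≠ s → j ≠ s → i ≠ j → A i j ∈ tau x y z (wcol i) (wcol j)}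
    ?_ ?_ (fun l => tau x y z (wcol s) (wcol l)) (fun l => tau_meas _ _ _ _ _)
    (fun l _ _ => tau_sub hxy hzy _ _) ?_
  · intro h0
    apply key
    refine measure_mono_null_ae ?_ h0
    filter_upwards [hsym] with A hA
    rintro ⟨hB, h1, h2, h3⟩ i hi j hj hij
    have h1' : ∀ l < N, l ≠ s → A l s ∈ tau x y z (wcol l) (wcol s) := fun l hl hls => by
      rw [hA, tau_comm]; exact h1 l hl hls
    have h2' : ∀ l < N, l ≠ s → A l N ∈ tau x y z (wcol l) (wcol s) := fun l hl hls => by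
      rw [hA, tau_comm]; exact h2 l hl hls
    have h3' : A N s ≤ y := by rw [hA]; exact h3
    have hss : tau x y z (wcol s) (wcol s) = Set.Iic y := by simp [tau]
    rcases Nat.lt_succ_iff_lt_or_eq.1 hi with hi | rfl <;>
    rcases Nat.lt_succ_iff_lt_or_eq.1 hj with hj | hj
    · by_cases his : i = s
      · subst his; exact h1 j hj (Ne.symm hij)
      · by_cases hjs : j = s
        · subst hjs; exact h1' i hi hij
        · exact hB i j hi hj his hjs hij
    · subst hj
      rw [← hsw]
      by_cases his : i = s
      · subst his; rw [hss]; exact h3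
      · exact h2' i hi his
    · rw [← hsw]
      by_cases hjs : j = s
      · subst hjs; rw [hss]; exact h3'
      · exact h2 j hj hjs
    · exact absurd hj.symm hij
  · have : {A : Arr | ∀ i, ∀ j, i < N → j < N → i ≠ s → j ≠ s → i ≠ j →
        A i j ∈ tau x y z (wcol i) (wcol j)} = ⋂ i, ⋂ j, ⋂ (_ : i < N), ⋂ (_ : j < N),
        ⋂ (_ : i ≠ s), ⋂ (_ : j ≠ s), ⋂ (_ : i ≠ j),
          (fun A : Arr => A i j) ⁻¹' tau x y z (wcol i) (wcol j) := by
      ext A; simp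
    rw [this]
    exact MeasurableSet.iInter fun i => MeasurableSet.iInter fun j =>
      MeasurableSet.iInter fun _ => MeasurableSet.iInter fun _ => MeasurableSet.iInter fun _ =>
      MeasurableSet.iInter fun _ => MeasurableSet.iInter fun _ =>
      (show Measurable fun A : Arr => A i j by fun_prop) (tau_meas _ _ _ _ _)
  · intro A A' hA h i j hi hj his hjs hij
    rw [← hA i hi j hj his hjs]; exact h i j hi hj his hjs hij
  · intro h0
    apply h
    refine measure_mono_null ?_ h0
    intro A hA
    exact ⟨fun i j hi hj _ _ hij => hA i hi j hj hij, fun l hl hls => hA s hs l hl (Ne.symm hls)⟩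

lemma wcol_cases (i : ℕ) : (i = 1 ∧ wcol i = 0) ∨ (i ≠ 1 ∧ wcol i = 1) ∨ (i ≠ 1 ∧ wcol i = -1) := by
  match i with
  | 0 => simp [wcol]
  | 1 => simp [wcol]
  | n + 2 => by_cases hn : n % 2 = 0 <;> simp [wcol, hn]

lemma wcol_sum (K : ℕ) : ∑ i ∈ Finset.range (2 * (K + 1) + 1), (wcol i : ℝ) = 0 ∧
    ∑ i ∈ Finset.range (2 * (K + 1) + 1), (wcol i : ℝ) ^ 2 = 2 * (K + 1) := by
  induction K with
  | zero => simp [Finset.sum_range_succ, wcol]; norm_num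
  | succ K ih =>
    have e1 : wcol (2 * (K + 1) + 1) = 1 := by
      rw [show 2 * (K + 1) + 1 = (2 * K + 1) + 2 by ring]; simp [wcol]
    have e2 : wcol (2 * (K + 1) + 2) = -1 := by
      simp [wcol]
    rw [show 2 * (K + 1 + 1) + 1 = (2 * (K + 1) + 1 + 1) + 1 by ring]
    simp only [Finset.sum_range_succ _ (2 * (K + 1) + 1 + 1),
      Finset.sum_range_succ _ (2 * (K + 1) + 1), ih.1, ih.2]
    rw [show 2 * (K + 1) + 1 + 1 = 2 * (K + 1) + 2 by ring, e1, e2]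
    push_cast
    constructor <;> ring

/-- The positive semidefiniteness bound. -/
lemma psd_bound {x y z : ℝ} (K : ℕ) (A : Arr) (hdiag : ∀ i, A i i = 1)
    (hP : A ∈ Pat x y z (2 * (K + 1) + 1))
    (hpsd : Matrix.PosSemidef (Matrix.of fun i j : Fin (2 * (K + 1) + 1) => A i j)) :
    ((K : ℝ) + 1) * (x - z) ^ 2 ≤ 2 * (1 - y) := by
  obtain ⟨hw1, hw2⟩ := wcol_sum K
  set N := 2 * (K + 1) + 1 with hN
  let δ : ℕ → ℝ := fun i => if i = 1 then 1 else 0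
  have hδ : ∑ i ∈ Finset.range N, δ i = 1 := by
    simp [δ, hN]
  let w : ℕ → ℝ := fun i => wcol i
  have hw1' : ∑ i ∈ Finset.range N, w i = 0 := hw1
  have hw2' : ∑ i ∈ Finset.range N, w i ^ 2 = 2 * (K + 1) := hw2
  have hQ : ∀ t : ℝ, 0 ≤ ∑ i ∈ Finset.range N, ∑ j ∈ Finset.range N,
      (w i + t * δ i) * (w j + t * δ j) * A i j := by
    intro t
    have h := hpsd.dotProduct_mulVec_nonneg (fun i : Fin N => w i + t * δ i)
    simp only [dotProduct, Matrix.mulVec, Matrix.of_apply, Pi.star_apply, star_trivial,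
      Finset.mul_sum] at h
    rw [Finset.sum_range]
    simp_rw [Finset.sum_range]
    refine h.trans (le_of_eq ?_)
    refine Finset.sum_congr rfl fun i _ => Finset.sum_congr rfl fun j _ => ?_
    ring
  have hb : ∀ t : ℝ, ∀ i ∈ Finset.range N, ∀ j ∈ Finset.range N,
      (w i + t * δ i) * (w j + t * δ j) * A i j ≤
      y * (w i * w j) + (if i = j then (1 - y) * w i ^ 2 else 0)
      + t * (x + z) / 2 * (δ i * w j) + t * (x - z) / 2 * (δ i * w j ^ 2)
      + t * (x + z) / 2 * (w i * δ j) + t * (x - z) / 2 * (w i ^ 2 * δ j)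
      + t ^ 2 * (δ i * δ j) := by
    intro t i hi j hj
    rw [Finset.mem_range] at hi hj
    by_cases hij : i = j
    · subst hij
      rw [hdiag]
      rcases wcol_cases i with ⟨h1, h2⟩ | ⟨h1, h2⟩ | ⟨h1, h2⟩ <;> simp [w, δ, h1, h2, -one_div] <;>
        (try simp [h1] at h2) <;> (try simp [h2]) <;> nlinarith
    · have hA := hP i hi j hj hij
      generalize A i j = r at hA ⊢
      rcases wcol_cases i with ⟨h1, h2⟩ | ⟨h1, h2⟩ | ⟨h1, h2⟩ <;>
      rcases wcol_cases j with ⟨h3, h4⟩ | ⟨h3, h4⟩ | ⟨h3, h4⟩ <;>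
      simp only [h2, h4, tau] at hA <;> norm_num at hA <;>
      simp only [w, δ, h2, h4, hij] <;> simp only [h1, h3] <;>
      first
        | (exfalso; omega)
        | (norm_num; done)
        | (norm_num; exact hA)
        | (rw [hA]; norm_num; done)
        | (rw [hA]; norm_num; linarith)
  have hsum : ∀ t : ℝ, 0 ≤ (1 - y) * (2 * (K + 1)) + t * (x - z) * (2 * (K + 1)) + t ^ 2 := by
    intro t
    refine (hQ t).trans ((Finset.sum_le_sum fun i hi => Finset.sum_le_sum fun j hj =>
      hb t i hi j hj).trans (le_of_eq ?_))
    simp only [Finset.sum_add_distrib, ← Finset.mul_sum, ← Finset.sum_mul, hδ, hw1', hw2']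
    have : ∑ i ∈ Finset.range N, ∑ j ∈ Finset.range N, (if i = j then (1 - y) * w i ^ 2 else 0)
        = (1 - y) * (2 * (K + 1)) := by
      rw [← hw2', Finset.mul_sum]
      refine Finset.sum_congr rfl fun i hi => ?_
      rw [Finset.sum_ite_eq, if_pos hi]
    rw [this]
    ring
  have h := hsum (-((K + 1) * (x - z)))
  have hK : (0 : ℝ) < K + 1 := by positivity
  have : 0 ≤ (K + 1 : ℝ) * (2 * (1 - y) - (K + 1) * (x - z) ^ 2) := by
    refine h.trans (le_of_eq ?_); ring
  have := nonneg_of_mul_nonneg_right this hK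
  linarith

/-- Main theorem: a symmetric, positive semidefinite, weakly exchangeable
random array with unit diagonal, whose off-diagonal entries take finitely many values
`q 0 < … < q (k-1)` with `q 0 ≥ 0`, and which satisfies the Ghirlanda–Guerra identities,
is ultrametric: `P(R₂₃ ≥ min (R₁₂, R₁₃)) = 1`. -/
theorem GG_implies_ultrametric
    {Ω : Type*} [MeasurableSpace Ω] (ℙ : Measure Ω) [IsProbabilityMeasure ℙ]
    {k : ℕ} (hk : 0 < k) (q : Fin k → ℝ) (hq : StrictMono q) (hq0 : 0 ≤ q ⟨0, hk⟩)
    (R : ℕ → ℕ → Ω → ℝ)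
    (hmeas : ∀ l l', Measurable (fun ω => R l l' ω))
    (hsymm : ∀ l l' ω, R l l' ω = R l' l ω)
    (hdiag : ∀ l ω, R l l ω = 1)
    (hpsd : ∀ᵐ ω ∂ℙ, ∀ n : ℕ,
      Matrix.PosSemidef (Matrix.of fun i j : Fin n => R i j ω))
    (hvals : ∀ᵐ ω ∂ℙ, ∀ l l', l ≠ l' → R l l' ω ∈ Set.range q)
    (hexch : ∀ (m : ℕ) (ρ : Equiv.Perm (Fin m)),
      Measure.map (fun ω => fun i j : Fin m => R (ρ i) (ρ j) ω) ℙ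
        = Measure.map (fun ω => fun i j : Fin m => R i j ω) ℙ)
    (hGG : ∀ m, 2 ≤ m → ∀ f : (Fin m → Fin m → ℝ) → ℝ, Measurable f →
      (∃ C, ∀ x, |f x| ≤ C) → ∀ ψ : ℝ → ℝ, Measurable ψ → (∃ C, ∀ x, |ψ x| ≤ C) →
      ∫ ω, f (fun i j : Fin m => R i j ω) * ψ (R 0 m ω) ∂ℙ
        = (1 / m) * (∫ ω, f (fun i j : Fin m => R i j ω) ∂ℙ)
              * (∫ ω, ψ (R 0 1 ω) ∂ℙ)
          + (1 / m) * ∑ l ∈ Finset.Ico 1 m,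
              ∫ ω, f (fun i j : Fin m => R i j ω) * ψ (R 0 l ω) ∂ℙ) :
    ℙ {ω | min (R 0 1 ω) (R 0 2 ω) ≤ R 1 2 ω} = 1 := by
  have hm := meas_arr hmeas
  set μ := ℙ.map (fun ω => (fun i j => R i j ω : Arr)) with hμ
  have : IsProbabilityMeasure μ := Measure.isProbabilityMeasure_map hm.aemeasurable
  have hE : Exch μ := exch_of ℙ R hmeas hexch
  have hG : GG0 μ := gg0_of ℙ R hmeas hGG
  have hsymset : MeasurableSet {A : Arr | ∀ i j, A i j = A j i} := by
    have : {A : Arr | ∀ i j, A i j = A j i} = ⋂ i, ⋂ j, {A : Arr | A i j = A j i} := by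
      ext A; simp
    rw [this]
    exact MeasurableSet.iInter fun i => MeasurableSet.iInter fun j =>
      measurableSet_eq_fun (by fun_prop) (by fun_prop)
  have hsym : ∀ᵐ A ∂μ, ∀ i j, A i j = A j i := by
    rw [hμ, ae_map_iff hm.aemeasurable hsymset]
    exact Filter.Eventually.of_forall fun ω i j => hsymm i j ω
  -- no bad triples, ordered version
  have core : ∀ x y z : ℝ, z < x → x ≤ y →
      μ {A | A 0 1 = x ∧ A 0 2 = y ∧ A 1 2 = z} = 0 := by
    intro x y z hzx hxy
    by_contra hne
    have hpat : ∀ n, μ (Pat x y z (n + 3)) ≠ 0 := by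
      intro n
      induction n with
      | zero =>
        intro h0
        apply hne
        refine measure_mono_null_ae ?_ h0
        filter_upwards [hsym] with A hA
        rintro ⟨h1, h2, h3⟩ i hi j hj hij
        have h1' := hA 0 1 ▸ h1
        have h2' := hA 0 2 ▸ h2
        have h3' := hA 1 2 ▸ h3
        have hi : i < 3 := hi
        have hj : j < 3 := hj
        interval_cases i <;> interval_cases j <;> simp_all [tau, wcol]
      | succ n ih => exact pat_step hG hE hsym hxy (by linarith) (by omega) ih
    obtain ⟨K, hK⟩ := exists_nat_gt (2 * (1 - y) / (x - z) ^ 2)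
    have hp := hpat (2 * K)
    have hp' : ¬ ∀ᵐ ω ∂ℙ, (fun i j => R i j ω : Arr) ∉ Pat x y z (2 * K + 3) := by
      intro hc
      apply hp
      have hPm : MeasurableSet (Pat x y z (2 * K + 3)) := by
        have : Pat x y z (2 * K + 3) = ⋂ i, ⋂ (_ : i < 2 * K + 3), ⋂ j, ⋂ (_ : j < 2 * K + 3),
            ⋂ (_ : i ≠ j), (fun A : Arr => A i j) ⁻¹' tau x y z (wcol i) (wcol j) := by
          ext A; simp [Pat]
        rw [this]
        exact MeasurableSet.iInter fun i => MeasurableSet.iInter fun _ =>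
          MeasurableSet.iInter fun j => MeasurableSet.iInter fun _ => MeasurableSet.iInter fun _ =>
          (show Measurable fun A : Arr => A i j by fun_prop) (tau_meas _ _ _ _ _)
      rw [hμ, Measure.map_apply hm hPm]
      exact measure_eq_zero_iff_ae_notMem.2 hc
    apply hp'
    filter_upwards [hpsd] with ω hω hP
    have hb := psd_bound K (fun i j => R i j ω) (fun i => hdiag i ω) hP (hω _)
    have hpos : 0 < (x - z) ^ 2 := by
      have : 0 < x - z := by linarith
      positivity
    rw [div_lt_iff₀ hpos] at hK
    nlinarith
  have core2 : ∀ x y z : ℝ, z < min x y →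
      μ {A | A 0 1 = x ∧ A 0 2 = y ∧ A 1 2 = z} = 0 := by
    intro x y z hz
    rw [lt_min_iff] at hz
    rcases le_total x y with h | h
    · exact core x y z hz.1 h
    · have hms : ∀ x y z : ℝ, MeasurableSet {A : Arr | A 0 1 = x ∧ A 0 2 = y ∧ A 1 2 = z} := by
        intro x y z
        refine MeasurableSet.inter (measurableSet_eq_fun (by fun_prop) (by fun_prop))
          (MeasurableSet.inter (measurableSet_eq_fun (by fun_prop) (by fun_prop))
            (measurableSet_eq_fun (by fun_prop) (by fun_prop)))
      have h1 := hE 3 1 (by omega) 2 (by omega) _ (hms y x z) ?_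
      · rw [core y x z hz.2 h] at h1
        refine measure_mono_null_ae ?_ h1
        filter_upwards [hsym] with A hA
        rintro ⟨a1, a2, a3⟩
        have e0 : Equiv.swap 1 2 0 = 0 := by decide
        refine ⟨?_, ?_, ?_⟩
        · simpa [swapArr, e0] using a2
        · simpa [swapArr, e0] using a1
        · simpa [swapArr, hA 2 1] using a3
      · rintro A A' hA ⟨a1, a2, a3⟩
        exact ⟨by rw [← hA 0 (by omega) 1 (by omega)]; exact a1,
          by rw [← hA 0 (by omega) 2 (by omega)]; exact a2,
          by rw [← hA 1 (by omega) 2 (by omega)]; exact a3⟩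
  have hfin : ∀ a b c : Fin k, ∀ᵐ ω ∂ℙ,
      ¬ (R 0 1 ω = q a ∧ R 0 2 ω = q b ∧ R 1 2 ω = q c ∧ q c < min (q a) (q b)) := by
    intro a b c
    by_cases hc : q c < min (q a) (q b)
    · have h := core2 _ _ _ hc
      have h2 : ∀ᵐ A ∂μ, A ∉ {A : Arr | A 0 1 = q a ∧ A 0 2 = q b ∧ A 1 2 = q c} :=
        measure_eq_zero_iff_ae_notMem.1 h
      have h3 := ae_of_ae_map hm.aemeasurable h2
      filter_upwards [h3] with ω hω
      rintro ⟨a1, a2, a3, _⟩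
      exact hω ⟨a1, a2, a3⟩
    · exact Filter.Eventually.of_forall fun ω h => hc h.2.2.2
  have hae : ∀ᵐ ω ∂ℙ, min (R 0 1 ω) (R 0 2 ω) ≤ R 1 2 ω := by
    have hall : ∀ᵐ ω ∂ℙ, ∀ a b c : Fin k,
        ¬ (R 0 1 ω = q a ∧ R 0 2 ω = q b ∧ R 1 2 ω = q c ∧ q c < min (q a) (q b)) :=
      ae_all_iff.2 fun a => ae_all_iff.2 fun b => ae_all_iff.2 fun c => hfin a b c
    filter_upwards [hall, hvals] with ω h1 h2
    obtain ⟨a, ha⟩ := h2 0 1 (by omega)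
    obtain ⟨b, hb⟩ := h2 0 2 (by omega)
    obtain ⟨c, hc⟩ := h2 1 2 (by omega)
    have := h1 a b c
    rw [← ha, ← hb, ← hc]
    by_contra hlt
    exact this ⟨ha.symm, hb.symm, hc.symm, not_le.1 hlt⟩
  have h1 : ℙ {ω | min (R 0 1 ω) (R 0 2 ω) ≤ R 1 2 ω} = ℙ Set.univ :=
    measure_congr (Filter.eventuallyEq_univ.2 hae)
  rw [h1, measure_univ]
end
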